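/- The subgroup of SL(2,ℤ) generated by the three matrices [[1,1],[0,1]], [[-1,0],[0,-1]] and [[1,0],[2,1]] consists exactly of those matrices [[a,b],[c,d]] ∈ SL(2,ℤ) whose lower-left entry c is even. -/

import Mathlib

open Matrix

/-- The elementary lower triangular matrix with lower-left entry `2`. -/
def lowerTwo : Matrix.SpecialLinearGroup (Fin 2) ℤ :=
  ⟨!![1, 0; 2, 1], by simp [Matrix.det_fin_two]⟩

lemma coe_lowerTwo : (lowerTwo : Matrix (Fin 2) (Fin 2) ℤ) = !![1, 0; 2, 1] := rfl

lemma coe_lowerTwo_inv : ((lowerTwo⁻¹ : Matrix.SpecialLinearGroup (Fin 2) ℤ) :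
    Matrix (Fin 2) (Fin 2) ℤ) = !![1, 0; -2, 1] := by
  simp [Matrix.SpecialLinearGroup.coe_inv, coe_lowerTwo, Matrix.adjugate_fin_two]

/-- An integer matrix of determinant one with vanishing lower-left entry is `± T ^ n`. -/
lemma exists_eq_T_zpow_or_neg_of_lower_left_eq_zero {A : Matrix.SpecialLinearGroup (Fin 2) ℤ}
    (hc : A 1 0 = 0) : ∃ n : ℤ, A = ModularGroup.T ^ n ∨ A = -ModularGroup.T ^ n := by
  have hdet : A 0 0 * A 1 1 = 1 := by
    have h := A.det_coe
    rw [Matrix.det_fin_two, hc] at h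
    simpa using h
  rcases Int.mul_eq_one_iff_eq_one_or_neg_one.mp hdet with ⟨ha, hd⟩ | ⟨ha, hd⟩
  · refine ⟨A 0 1, Or.inl ?_⟩
    ext i j
    rw [ModularGroup.coe_T_zpow]
    fin_cases i <;> fin_cases j <;> simp [ha, hd, hc]
  · refine ⟨-A 0 1, Or.inr ?_⟩
    ext i j
    rw [Matrix.SpecialLinearGroup.coe_neg, ModularGroup.coe_T_zpow]
    fin_cases i <;> fin_cases j <;> simp [ha, hd, hc]

/-- A subgroup containing `T`, `-1` and `lowerTwo` contains every matrix whose lower-left entry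
is even, by descent on the size of the first column. -/
lemma mem_of_even_lower_left {H : Subgroup (Matrix.SpecialLinearGroup (Fin 2) ℤ)}
    (hT : ModularGroup.T ∈ H) (hN : -1 ∈ H) (hL : lowerTwo ∈ H)
    (A : Matrix.SpecialLinearGroup (Fin 2) ℤ) (hA : Even (A 1 0)) : A ∈ H := by
  induction hn : (A 0 0).natAbs + (A 1 0).natAbs using Nat.strong_induction_on
    generalizing A with
  | _ n ih =>
    subst hn
    have descend (g : Matrix.SpecialLinearGroup (Fin 2) ℤ) (hg : g ∈ H)
        (heven : Even ((g * A) 1 0))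
        (hlt : ((g * A) 0 0).natAbs + ((g * A) 1 0).natAbs
          < (A 0 0).natAbs + (A 1 0).natAbs) : A ∈ H :=
      (H.mul_mem_cancel_left hg).mp (ih _ hlt _ heven rfl)
    have hT₀ : (ModularGroup.T * A) 0 0 = A 0 0 + A 1 0 := by
      simp [ModularGroup.coe_T, Matrix.mul_apply, Fin.sum_univ_two]
    have hT₁ : (ModularGroup.T * A) 1 0 = A 1 0 := by
      simp
    have hTi₀ : (ModularGroup.T⁻¹ * A) 0 0 = A 0 0 - A 1 0 := by
      simp [Matrix.mul_apply, Fin.sum_univ_two, sub_eq_add_neg]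
    have hTi₁ : (ModularGroup.T⁻¹ * A) 1 0 = A 1 0 := by
      simp
    have hL₀ : (lowerTwo * A) 0 0 = A 0 0 := by
      simp [Matrix.SpecialLinearGroup.coe_mul, coe_lowerTwo, Matrix.mul_apply, Fin.sum_univ_two,
        -Matrix.SpecialLinearGroup.coe_inv]
    have hL₁ : (lowerTwo * A) 1 0 = 2 * A 0 0 + A 1 0 := by
      simp [Matrix.SpecialLinearGroup.coe_mul, coe_lowerTwo, Matrix.mul_apply, Fin.sum_univ_two,
        -Matrix.SpecialLinearGroup.coe_inv]
    have hLi₀ : (lowerTwo⁻¹ * A) 0 0 = A 0 0 := by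
      simp [Matrix.SpecialLinearGroup.coe_mul, coe_lowerTwo_inv, Matrix.mul_apply, Fin.sum_univ_two,
        -Matrix.SpecialLinearGroup.coe_inv]
    have hLi₁ : (lowerTwo⁻¹ * A) 1 0 = -2 * A 0 0 + A 1 0 := by
      simp [Matrix.SpecialLinearGroup.coe_mul, coe_lowerTwo_inv, Matrix.mul_apply, Fin.sum_univ_two,
        -Matrix.SpecialLinearGroup.coe_inv]
    have ha : Odd (A 0 0) := by
      have h := A.det_coe
      rw [Matrix.det_fin_two] at h
      have hodd : Odd (A 0 0 * A 1 1) := by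
        rw [sub_eq_iff_eq_add.mp h]
        exact odd_one.add_even (hA.mul_left _)
      exact (Int.odd_mul.mp hodd).1
    by_cases hc : A 1 0 = 0
    · obtain ⟨k, hk | hk⟩ := exists_eq_T_zpow_or_neg_of_lower_left_eq_zero hc
      · exact hk ▸ H.zpow_mem hT k
      · rw [hk, ← neg_one_mul]
        exact H.mul_mem hN (H.zpow_mem hT k)
    · obtain ⟨r, hr⟩ := ha
      obtain ⟨s, hs⟩ := hA
      rcases lt_or_ge (A 1 0).natAbs (A 0 0).natAbs with hlt | hge
      · by_cases hsign : 0 < A 0 0 ↔ 0 < A 1 0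
        · exact descend _ (H.inv_mem hT) (by rw [hTi₁]; exact ⟨s, hs⟩)
            (by rw [hTi₀, hTi₁]; omega)
        · exact descend _ hT (by rw [hT₁]; exact ⟨s, hs⟩) (by rw [hT₀, hT₁]; omega)
      · by_cases hsign : 0 < A 0 0 ↔ 0 < A 1 0
        · exact descend _ (H.inv_mem hL) (by rw [hLi₁]; exact ⟨-A 0 0 + s, by omega⟩)
            (by rw [hLi₀, hLi₁]; omega)
        · exact descend _ hL (by rw [hL₁]; exact ⟨A 0 0 + s, by omega⟩)
            (by rw [hL₀, hL₁]; omega)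

/-- The subgroup of `SL(2,ℤ)` generated by `[[1,1],[0,1]]`,
`[[-1,0],[0,-1]]` and `[[1,0],[2,1]]` consists exactly of those matrices in
`SL(2,ℤ)` whose lower-left entry is even. -/
theorem SL2_even_c_generated (A : Matrix.SpecialLinearGroup (Fin 2) ℤ) :
    A ∈ Subgroup.closure {B : Matrix.SpecialLinearGroup (Fin 2) ℤ |
        (B : Matrix (Fin 2) (Fin 2) ℤ) = !![1, 1; 0, 1] ∨
        (B : Matrix (Fin 2) (Fin 2) ℤ) = !![-1, 0; 0, -1] ∨
        (B : Matrix (Fin 2) (Fin 2) ℤ) = !![1, 0; 2, 1]} ↔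
      Even ((A : Matrix (Fin 2) (Fin 2) ℤ) 1 0) := by
  constructor
  · intro hA
    have hle : Subgroup.closure {B : Matrix.SpecialLinearGroup (Fin 2) ℤ |
        (B : Matrix (Fin 2) (Fin 2) ℤ) = !![1, 1; 0, 1] ∨
        (B : Matrix (Fin 2) (Fin 2) ℤ) = !![-1, 0; 0, -1] ∨
        (B : Matrix (Fin 2) (Fin 2) ℤ) = !![1, 0; 2, 1]} ≤ CongruenceSubgroup.Gamma0 2 := by
      rw [Subgroup.closure_le]
      rintro B (hB | hB | hB) <;>
        rw [SetLike.mem_coe, CongruenceSubgroup.Gamma0_mem, hB] <;> simp; rfl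
    exact (ZMod.intCast_eq_zero_iff_even).mp (CongruenceSubgroup.Gamma0_mem.mp (hle hA))
  · refine mem_of_even_lower_left (Subgroup.subset_closure (Or.inl ModularGroup.coe_T))
      (Subgroup.subset_closure (Or.inr (Or.inl ?_)))
      (Subgroup.subset_closure (Or.inr (Or.inr rfl))) A
    ext i j
    fin_cases i <;> fin_cases j <;> simp
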